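/- Let A_1 ⊂ A_2 ⊂ ⋯ ⊂ E be arbitrary sets with cap_p(A_j, E) < ∞ for all j = 1, 2, …. For each j let G_j ⊂ E be such that G_j ⊃ A_j and cap_p(G_j, E) ≤ cap_p(A_j, E) + ε_j, where ε_j > 0 are arbitrary. Let G̃_k = ⋃_{j=1}^k G_j. Then for all k = 1, 2, …, cap_p(G̃_k, E) ≤ cap_p(A_k, E) + ∑_{j=1}^k ε_j. -/

import Mathlib

open MeasureTheory Metric Set Filter
open scoped ENNReal NNReal Topology

noncomputable section

variable {X : Type*} [MetricSpace X] [MeasurableSpace X] [BorelSpace X]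

/-- A nonconstant, compact, rectifiable curve in `X`, parameterized by arc length on
`[0, len]`. The arc-length parameterization is expressed by requiring that the length
(total variation) of the curve on each subinterval `[s, t]` equals `t - s`. -/
structure Curve (X : Type*) [MetricSpace X] where
  len : ℝ
  len_pos : 0 < len
  toFun : ℝ → X
  continuousOn : ContinuousOn toFun (Set.Icc 0 len)
  arclength : ∀ s t : ℝ, s ∈ Set.Icc 0 len → t ∈ Set.Icc 0 len → s ≤ t →
    eVariationOn toFun (Set.Icc s t) = ENNReal.ofReal (t - s)
  nonconstant : ∃ s ∈ Set.Icc 0 len, ∃ t ∈ Set.Icc 0 len, toFun s ≠ toFun t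

/-- The curve integral `∫_γ g ds` of a nonnegative function along an arc-length
parameterized curve. -/
def Curve.integral (γ : Curve X) (g : X → ℝ≥0∞) : ℝ≥0∞ :=
  ∫⁻ t in Set.Icc (0 : ℝ) γ.len, g (γ.toFun t)

/-- `|a - b|` with the convention that it is `∞` whenever both `a` and `b` are infinite. -/
def ugDiff (a b : EReal) : ℝ≥0∞ :=
  if a.abs = ⊤ ∨ b.abs = ⊤ then ⊤ else (a - b).abs

/-- The upper gradient inequality for `f` and `g` along the curve `γ`. -/
def UGOn (f : X → EReal) (g : X → ℝ≥0∞) (γ : Curve X) : Prop :=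
  ugDiff (f (γ.toFun 0)) (f (γ.toFun γ.len)) ≤ γ.integral g

/-- A curve family has zero `p`-modulus. -/
def ZeroModulus (p : ℝ) (μ : Measure X) (Γ : Set (Curve X)) : Prop :=
  ∃ ρ : X → ℝ≥0∞, Measurable ρ ∧ (∫⁻ x, ρ x ^ p ∂μ) < ⊤ ∧ ∀ γ ∈ Γ, γ.integral ρ = ⊤

/-- `g` is an upper gradient of `f`. -/
def IsUpperGradient (f : X → EReal) (g : X → ℝ≥0∞) : Prop :=
  Measurable g ∧ ∀ γ : Curve X, UGOn f g γ

/-- `g` is a `p`-weak upper gradient of `f`: the upper gradient inequality holds for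
`p`-almost every curve. -/
def IsWeakUpperGradient (p : ℝ) (μ : Measure X) (f : X → EReal) (g : X → ℝ≥0∞) : Prop :=
  Measurable g ∧ ZeroModulus p μ {γ : Curve X | ¬ UGOn f g γ}

/-- The energy `∫_X g_u^p dμ` of the minimal `p`-weak upper gradient of `u`, expressed as
the infimum of `∫_X g^p dμ` over all `p`-weak upper gradients `g` of `u`
(`= ∞` if `u` has no `p`-weak upper gradient). -/
def gradEnergy (p : ℝ) (μ : Measure X) (u : X → EReal) : ℝ≥0∞ :=
  ⨅ (g : X → ℝ≥0∞) (_ : IsWeakUpperGradient p μ u g), ∫⁻ x, g x ^ p ∂μ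

/-- The Newtonian energy `‖u‖_{N^{1,p}(X)}^p = ∫_X |u|^p dμ + ∫_X g_u^p dμ`. -/
def newtonianEnergy (p : ℝ) (μ : Measure X) (u : X → EReal) : ℝ≥0∞ :=
  (∫⁻ x, (u x).abs ^ p ∂μ) + gradEnergy p μ u

/-- Membership in the Newtonian space `N^{1,p}(X)` (measurability is with respect to the
completion of the Borel σ-algebra, i.e. a.e.-measurability). -/
def MemNewtonian (p : ℝ) (μ : Measure X) (u : X → EReal) : Prop :=
  AEMeasurable u μ ∧ newtonianEnergy p μ u < ⊤

/-- Membership in `N^{1,p}_0(E)`, members being regarded as functions on all of `X`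
that vanish outside `E`. -/
def MemNewtonian0 (p : ℝ) (μ : Measure X) (E : Set X) (u : X → EReal) : Prop :=
  MemNewtonian p μ u ∧ ∀ x ∉ E, u x = 0

/-- The Sobolev capacity `C_p(A)`. -/
def sobolevCapacity (p : ℝ) (μ : Measure X) (A : Set X) : ℝ≥0∞ :=
  ⨅ (u : X → EReal) (_ : MemNewtonian p μ u ∧ ∀ x ∈ A, u x = 1), newtonianEnergy p μ u

/-- The variational capacity `cap_p(A, E)`. -/
def varCapacity (p : ℝ) (μ : Measure X) (A E : Set X) : ℝ≥0∞ :=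
  ⨅ (u : X → EReal) (_ : MemNewtonian0 p μ E u ∧ ∀ x ∈ A, 1 ≤ u x), gradEnergy p μ u

/-- A function is quasicontinuous if outside open sets of arbitrarily small Sobolev
capacity it is real-valued and continuous. -/
def QuasicontinuousFun (p : ℝ) (μ : Measure X) (u : X → EReal) : Prop :=
  ∀ ε : ℝ≥0∞, 0 < ε → ∃ G : Set X, IsOpen G ∧ sobolevCapacity p μ G < ε ∧
    (∀ x ∈ Gᶜ, u x ≠ ⊤ ∧ u x ≠ ⊥) ∧ ContinuousOn u Gᶜ

/-- The capacity `~cap_p(A,E)`: the infimum of `cap_p(G,E)` over all relatively open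
subsets `G` of `E` containing `A`. -/
def varCapacityT (p : ℝ) (μ : Measure X) (A E : Set X) : ℝ≥0∞ :=
  ⨅ (G : Set X) (_ : A ⊆ G ∧ G ⊆ E ∧ ∃ U : Set X, IsOpen U ∧ G = U ∩ E),
    varCapacity p μ G E

/-- A real function whose increments on `[0, l]` are dominated by the integrals of `α` is
absolutely continuous, and its derivative is dominated by `α` almost everywhere. -/
lemma absolutelyContinuousOnInterval_of_le_setLIntegral {U : ℝ → ℝ} {α : ℝ → ℝ≥0∞} {l : ℝ}
    (hl : 0 ≤ l) (hm : AEMeasurable α (volume.restrict (Icc 0 l)))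
    (hfin : ∫⁻ t in Icc 0 l, α t ≠ ⊤)
    (hU : ∀ s ∈ Icc 0 l, ∀ t ∈ Icc 0 l, s ≤ t →
      ENNReal.ofReal |U s - U t| ≤ ∫⁻ r in Icc s t, α r) :
    AbsolutelyContinuousOnInterval U 0 l ∧
      ∀ᵐ t, t ∈ Icc 0 l → ENNReal.ofReal |deriv U t| ≤ α t := by
  have hint : IntegrableOn (fun t ↦ (α t).toReal) (Icc 0 l) :=
    integrable_toReal_of_lintegral_ne_top hm hfin
  have hii : IntervalIntegrable (fun t ↦ (α t).toReal) volume 0 l :=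
    (intervalIntegrable_iff_integrableOn_Icc_of_le hl).2 hint
  set F : ℝ → ℝ := fun x ↦ ∫ t in (0 : ℝ)..x, (α t).toReal with hF
  have hFac : AbsolutelyContinuousOnInterval F 0 l :=
    hii.absolutelyContinuousOnInterval_intervalIntegral (by simp)
  have hlt : ∀ᵐ t ∂(volume.restrict (Icc 0 l)), α t < ⊤ := ae_lt_top' hm hfin
  have hle : ∀ s ∈ Icc 0 l, ∀ t ∈ Icc 0 l, s ≤ t → |U s - U t| ≤ F t - F s := by
    intro s hs t ht hst
    have hsub : Icc s t ⊆ Icc 0 l := Icc_subset_Icc hs.1 ht.2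
    have h0 : ∀ r ∈ Icc 0 l, IntervalIntegrable (fun t ↦ (α t).toReal) volume 0 r := by
      intro r hr
      exact (intervalIntegrable_iff_integrableOn_Icc_of_le hr.1).2
        (hint.mono_set (Icc_subset_Icc le_rfl hr.2))
    have h1 : F t - F s = (∫⁻ r in Icc s t, α r).toReal := by
      rw [hF]
      simp only
      rw [intervalIntegral.integral_interval_sub_left (h0 t ht) (h0 s hs),
        intervalIntegral.integral_of_le hst, ← integral_Icc_eq_integral_Ioc,
        integral_toReal (hm.mono_measure (Measure.restrict_mono hsub le_rfl))
          (ae_restrict_of_ae_restrict_of_subset hsub hlt)]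
    rw [h1]
    exact (ENNReal.ofReal_le_iff_le_toReal
      ((lintegral_mono_set hsub).trans_lt hfin.lt_top).ne).1 (hU s hs t ht hst)
  have hdist : ∀ s ∈ Icc 0 l, ∀ t ∈ Icc 0 l, dist (U s) (U t) ≤ dist (F s) (F t) := by
    intro s hs t ht
    rcases le_total s t with h | h
    · rw [Real.dist_eq, dist_comm (F s), Real.dist_eq]
      exact (hle s hs t ht h).trans (le_abs_self _)
    · rw [dist_comm (U s), Real.dist_eq, Real.dist_eq]
      exact (hle t ht s hs h).trans (le_abs_self _)
  have hac : AbsolutelyContinuousOnInterval U 0 l := by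
    refine squeeze_zero' (Eventually.of_forall fun E ↦ Finset.sum_nonneg fun i _ ↦ dist_nonneg)
      ?_ hFac
    filter_upwards [mem_inf_of_right (mem_principal_self _)] with E hE
    have hE := hE.1
    rw [uIcc_of_le hl] at hE
    exact Finset.sum_le_sum fun i hi ↦ hdist _ (hE i hi).1 _ (hE i hi).2
  refine ⟨hac, ?_⟩
  have hne0 : ∀ᵐ t : ℝ, t ≠ 0 := by simp [ae_iff, measure_singleton]
  have hnel : ∀ᵐ t : ℝ, t ≠ l := by simp [ae_iff, measure_singleton]
  have hlt' := (ae_restrict_iff' measurableSet_Icc).1 hlt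
  filter_upwards [hac.ae_differentiableAt, hii.ae_hasDerivAt_integral, hne0, hnel, hlt']
    with t hUd hFd h0 hl' hαt ht
  have hIcc : Icc 0 l ∈ 𝓝 t :=
    Icc_mem_nhds (lt_of_le_of_ne ht.1 h0.symm) (lt_of_le_of_ne ht.2 hl')
  rw [uIcc_of_le hl] at hUd hFd
  have hd := (hasDerivAt_iff_tendsto_slope.1 (hUd ht).hasDerivAt).norm
  have hd' := (hasDerivAt_iff_tendsto_slope.1 (hFd ht 0 ⟨le_rfl, hl⟩)).norm
  have hfinal : ‖deriv U t‖ ≤ ‖(α t).toReal‖ := by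
    refine le_of_tendsto_of_tendsto hd hd' ?_
    filter_upwards [mem_nhdsWithin_of_mem_nhds hIcc] with s hs
    have h := hdist s hs t ht
    rw [dist_eq_norm, dist_eq_norm] at h
    rw [slope_def_module, slope_def_module, norm_smul, norm_smul]
    gcongr
  rw [Real.norm_of_nonneg ENNReal.toReal_nonneg] at hfinal
  exact ENNReal.ofReal_le_of_le_toReal hfinal

/-- The increment of `max U V` is dominated by the integral of any function which dominates
the gradient bound `α` of `U` where `V < U` and the gradient bound `β` of `V` elsewhere. -/
lemma ofReal_abs_max_sub_max_le_setLIntegral {U V : ℝ → ℝ} {α β H : ℝ → ℝ≥0∞} {l : ℝ}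
    (hl : 0 ≤ l)
    (hα : AEMeasurable α (volume.restrict (Icc 0 l))) (hαfin : ∫⁻ t in Icc 0 l, α t ≠ ⊤)
    (hβ : AEMeasurable β (volume.restrict (Icc 0 l))) (hβfin : ∫⁻ t in Icc 0 l, β t ≠ ⊤)
    (hU : ∀ s ∈ Icc 0 l, ∀ t ∈ Icc 0 l, s ≤ t →
      ENNReal.ofReal |U s - U t| ≤ ∫⁻ r in Icc s t, α r)
    (hV : ∀ s ∈ Icc 0 l, ∀ t ∈ Icc 0 l, s ≤ t →
      ENNReal.ofReal |V s - V t| ≤ ∫⁻ r in Icc s t, β r)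
    (hH : ∀ t ∈ Icc 0 l, V t < U t → α t ≤ H t) (hH' : ∀ t ∈ Icc 0 l, U t ≤ V t → β t ≤ H t) :
    ENNReal.ofReal |max (U 0) (V 0) - max (U l) (V l)| ≤ ∫⁻ t in Icc 0 l, H t := by
  obtain ⟨hUac, hUd⟩ := absolutelyContinuousOnInterval_of_le_setLIntegral hl hα hαfin hU
  obtain ⟨hVac, hVd⟩ := absolutelyContinuousOnInterval_of_le_setLIntegral hl hβ hβfin hV
  set W : ℝ → ℝ := fun t ↦ max (U t) (V t) with hW
  have hWac : AbsolutelyContinuousOnInterval W 0 l := by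
    refine (absolutelyContinuousOnInterval_of_le_setLIntegral (α := fun t ↦ α t + β t) hl
      (hα.add hβ) ?_ ?_).1
    · rw [lintegral_add_left' hα]
      exact ENNReal.add_ne_top.2 ⟨hαfin, hβfin⟩
    · intro s hs t ht hst
      rw [lintegral_add_left' (hα.mono_measure
        (Measure.restrict_mono (Icc_subset_Icc hs.1 ht.2) le_rfl))]
      refine le_trans ?_ (add_le_add (hU s hs t ht hst) (hV s hs t ht hst))
      rw [← ENNReal.ofReal_add (abs_nonneg _) (abs_nonneg _)]
      refine ENNReal.ofReal_le_ofReal ((abs_max_sub_max_le_max _ _ _ _).trans ?_)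
      exact max_le_add_of_nonneg (abs_nonneg _) (abs_nonneg _)
  have hne0 : ∀ᵐ t : ℝ, t ≠ 0 := by simp [ae_iff, measure_singleton]
  have hnel : ∀ᵐ t : ℝ, t ≠ l := by simp [ae_iff, measure_singleton]
  have hWd : ∀ᵐ t, t ∈ Icc 0 l → ‖deriv W t‖ₑ ≤ H t := by
    filter_upwards [hUd, hVd, hWac.ae_differentiableAt, hUac.ae_differentiableAt,
      hVac.ae_differentiableAt, hne0, hnel] with t hUt hVt hWdiff hUdiff hVdiff h0 hl' ht
    have hIcc : Icc 0 l ∈ 𝓝 t :=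
      Icc_mem_nhds (lt_of_le_of_ne ht.1 h0.symm) (lt_of_le_of_ne ht.2 hl')
    rw [uIcc_of_le hl] at hWdiff hUdiff hVdiff
    rw [Real.enorm_eq_ofReal_abs]
    have hUc := (hUdiff ht).continuousAt
    have hVc := (hVdiff ht).continuousAt
    rcases lt_or_ge (V t) (U t) with h | h
    · have : W =ᶠ[𝓝 t] U := by
        filter_upwards [hVc.eventually_lt hUc h] with s hs
        exact max_eq_left hs.le
      rw [this.deriv_eq]
      exact (hUt ht).trans (hH t ht h)
    · have : deriv W t = deriv V t := by
        have hmin : IsLocalMin (W - V) t := by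
          refine Eventually.of_forall fun s ↦ ?_
          simp only [Pi.sub_apply, hW, max_eq_right h, sub_self, sub_nonneg]
          exact le_max_right _ _
        have := hmin.deriv_eq_zero
        rw [deriv_sub (hWdiff ht) (hVdiff ht)] at this
        linarith
      rw [this]
      exact (hVt ht).trans (hH' t ht h)
  calc ENNReal.ofReal |max (U 0) (V 0) - max (U l) (V l)|
      = ‖∫ t in (0 : ℝ)..l, deriv W t‖ₑ := by
        rw [hWac.integral_deriv_eq_sub, Real.enorm_eq_ofReal_abs, abs_sub_comm]
    _ ≤ ∫⁻ t in Icc 0 l, ‖deriv W t‖ₑ := by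
        rw [intervalIntegral.integral_of_le hl, ← integral_Icc_eq_integral_Ioc]
        exact enorm_integral_le_lintegral_enorm _
    _ ≤ ∫⁻ t in Icc 0 l, H t :=
        lintegral_mono_ae ((ae_restrict_iff' measurableSet_Icc).2 hWd)

/-- The restriction of a curve to `[a, b]`, reparameterized on `[0, b - a]`. -/
def Curve.sub (γ : Curve X) (a b : ℝ) (ha : 0 ≤ a) (hab : a < b) (hb : b ≤ γ.len) :
    Curve X where
  len := b - a
  len_pos := sub_pos.2 hab
  toFun t := γ.toFun (a + t)
  continuousOn := by
    refine γ.continuousOn.comp (by fun_prop) fun t ht ↦ ?_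
    exact ⟨by linarith [ht.1], by linarith [ht.2]⟩
  arclength s t hs ht hst := by
    have h := eVariationOn.comp_eq_of_monotoneOn γ.toFun (t := Icc s t) (fun r ↦ a + r)
      (fun x _ y _ hxy ↦ by simpa using hxy)
    rw [image_const_add_Icc] at h
    refine h.trans ?_
    rw [γ.arclength (a + s) (a + t) ⟨by linarith [hs.1], by linarith [hs.2]⟩
      ⟨by linarith [ht.1], by linarith [ht.2]⟩ (by linarith)]
    congr 1
    ring
  nonconstant := by
    by_contra! hcon
    have hc : ∀ s ∈ Icc a b, γ.toFun s = γ.toFun a := by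
      intro s hs
      have := hcon (s - a) ⟨by linarith [hs.1], by linarith [hs.2]⟩ 0 ⟨le_rfl, by linarith⟩
      simpa using this
    have h0 : eVariationOn γ.toFun (Icc a b) = 0 := by
      refine eVariationOn.constant_on ?_
      rintro _ ⟨s, hs, rfl⟩ _ ⟨t, ht, rfl⟩
      rw [hc s hs, hc t ht]
    rw [γ.arclength a b ⟨ha, hab.le.trans hb⟩ ⟨ha.trans hab.le, hb⟩ hab.le] at h0
    simp only [ENNReal.ofReal_eq_zero] at h0
    linarith

lemma Curve.integral_sub (γ : Curve X) (g : X → ℝ≥0∞) {a b : ℝ} (ha : 0 ≤ a) (hab : a < b)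
    (hb : b ≤ γ.len) :
    (γ.sub a b ha hab hb).integral g = ∫⁻ t in Icc a b, g (γ.toFun t) := by
  have h := (measurePreserving_add_left volume a).setLIntegral_comp_emb
    (measurableEmbedding_addLeft a) (fun t ↦ g (γ.toFun t)) (Icc 0 (b - a))
  rw [image_const_add_Icc] at h
  simpa [Curve.integral, Curve.sub] using h

lemma Curve.aemeasurable_comp (γ : Curve X) {g : X → ℝ≥0∞} (hg : Measurable g) :
    AEMeasurable (fun t ↦ g (γ.toFun t)) (volume.restrict (Icc 0 γ.len)) :=
  hg.comp_aemeasurable (γ.continuousOn.aemeasurable measurableSet_Icc)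

lemma Curve.integral_add (γ : Curve X) {g : X → ℝ≥0∞} (hg : Measurable g) (h : X → ℝ≥0∞) :
    γ.integral (g + h) = γ.integral g + γ.integral h :=
  lintegral_add_left' (γ.aemeasurable_comp hg) _

lemma Curve.integral_sub_le (γ : Curve X) (g : X → ℝ≥0∞) {a b : ℝ} (ha : 0 ≤ a) (hab : a < b)
    (hb : b ≤ γ.len) : (γ.sub a b ha hab hb).integral g ≤ γ.integral g := by
  rw [γ.integral_sub]
  exact lintegral_mono_set (Icc_subset_Icc ha hb)

lemma EReal.coe_toReal_of_abs_ne_top {a : EReal} (h : a.abs ≠ ⊤) : (a.toReal : EReal) = a := by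
  induction a <;> simp_all

lemma ugDiff_coe (x y : ℝ) : ugDiff x y = ENNReal.ofReal |x - y| := by
  rw [ugDiff, if_neg, ← EReal.coe_sub, EReal.abs_def]
  exact not_or.2 ⟨(EReal.abs_coe_lt_top x).ne, (EReal.abs_coe_lt_top y).ne⟩

lemma abs_ne_top_of_ugDiff_ne_top {a b : EReal} (h : ugDiff a b ≠ ⊤) :
    a.abs ≠ ⊤ ∧ b.abs ≠ ⊤ := by
  rw [ugDiff] at h
  grind

lemma ugDiff_neg (a b : EReal) : ugDiff (-a) (-b) = ugDiff a b := by
  by_cases h : a.abs = ⊤ ∨ b.abs = ⊤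
  · simp [ugDiff, EReal.abs_neg, h]
  · obtain ⟨ha, hb⟩ := not_or.1 h
    rw [← EReal.coe_toReal_of_abs_ne_top ha, ← EReal.coe_toReal_of_abs_ne_top hb,
      ← EReal.coe_neg, ← EReal.coe_neg, ugDiff_coe, ugDiff_coe, neg_sub_neg, abs_sub_comm]

lemma IsWeakUpperGradient.neg {p : ℝ} {μ : Measure X} {u : X → EReal} {g : X → ℝ≥0∞}
    (h : IsWeakUpperGradient p μ u g) : IsWeakUpperGradient p μ (fun x ↦ -u x) g := by
  simpa only [IsWeakUpperGradient, UGOn, ugDiff_neg] using h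

/-- Along a curve with finite gradient integral on which every subcurve satisfies the upper
gradient inequality, `u` is finite and its real increments are controlled. -/
lemma Curve.real_of_forall_sub (γ : Curve X) {u : X → EReal} {g : X → ℝ≥0∞}
    (hfin : γ.integral g ≠ ⊤)
    (h : ∀ a b (ha : 0 ≤ a) (hab : a < b) (hb : b ≤ γ.len), UGOn u g (γ.sub a b ha hab hb)) :
    (∀ t ∈ Icc 0 γ.len, ((u (γ.toFun t)).toReal : EReal) = u (γ.toFun t)) ∧
    ∀ s ∈ Icc 0 γ.len, ∀ t ∈ Icc 0 γ.len, s ≤ t →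
      ENNReal.ofReal |(u (γ.toFun s)).toReal - (u (γ.toFun t)).toReal| ≤
        ∫⁻ r in Icc s t, g (γ.toFun r) := by
  have h' : ∀ a b, 0 ≤ a → a < b → b ≤ γ.len →
      ugDiff (u (γ.toFun a)) (u (γ.toFun b)) ≤ ∫⁻ r in Icc a b, g (γ.toFun r) := by
    intro a b ha hab hb
    have := h a b ha hab hb
    rw [UGOn, γ.integral_sub] at this
    simpa [Curve.sub] using this
  have hne : ∀ a b, 0 ≤ a → a < b → b ≤ γ.len →
      ugDiff (u (γ.toFun a)) (u (γ.toFun b)) ≠ ⊤ := by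
    intro a b ha hab hb
    have := (h' a b ha hab hb).trans (lintegral_mono_set (Icc_subset_Icc ha hb))
    exact (this.trans_lt hfin.lt_top).ne
  have hreal : ∀ t ∈ Icc 0 γ.len, ((u (γ.toFun t)).toReal : EReal) = u (γ.toFun t) := by
    intro t ht
    refine EReal.coe_toReal_of_abs_ne_top ?_
    rcases ht.1.eq_or_lt with rfl | h0
    · exact (abs_ne_top_of_ugDiff_ne_top (hne 0 γ.len le_rfl γ.len_pos le_rfl)).1
    · exact (abs_ne_top_of_ugDiff_ne_top (hne 0 t le_rfl h0 ht.2)).2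
  refine ⟨hreal, fun s hs t ht hst ↦ ?_⟩
  rcases hst.eq_or_lt with rfl | hst
  · simp
  · rw [← ugDiff_coe, hreal s hs, hreal t ht]
    exact h' s t hs.1 hst ht.2

lemma IsWeakUpperGradient.max {p : ℝ} (hp : 1 ≤ p) {μ : Measure X} {u v : X → EReal}
    {gu gv G : X → ℝ≥0∞} (hu : IsWeakUpperGradient p μ u gu) (hv : IsWeakUpperGradient p μ v gv)
    (hufin : ∫⁻ x, gu x ^ p ∂μ < ⊤) (hvfin : ∫⁻ x, gv x ^ p ∂μ < ⊤) (hG : Measurable G)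
    (h : ∀ x, v x < u x → gu x ≤ G x) (h' : ∀ x, u x ≤ v x → gv x ≤ G x) :
    IsWeakUpperGradient p μ (fun x ↦ max (u x) (v x)) G := by
  obtain ⟨hgu, ρ, hρ, hρfin, hρΓ⟩ := hu
  obtain ⟨hgv, σ, hσ, hσfin, hσΓ⟩ := hv
  refine ⟨hG, ρ + gu + (σ + gv), (hρ.add hgu).add (hσ.add hgv), ?_, fun γ hγ ↦ ?_⟩
  · refine ENNReal.lintegral_rpow_add_lt_top_of_lintegral_rpow_lt_top
      (hρ.add hgu).aemeasurable ?_ ?_ hp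
    · exact ENNReal.lintegral_rpow_add_lt_top_of_lintegral_rpow_lt_top hρ.aemeasurable hρfin
        hufin hp
    · exact ENNReal.lintegral_rpow_add_lt_top_of_lintegral_rpow_lt_top hσ.aemeasurable hσfin
        hvfin hp
  · by_contra hne
    apply hγ
    rw [γ.integral_add (hρ.add hgu), γ.integral_add hρ, γ.integral_add hσ] at hne
    simp only [ENNReal.add_eq_top, not_or] at hne
    obtain ⟨⟨hne₁, hne₂⟩, hne₃, hne₄⟩ := hne
    have key : ∀ {w : X → EReal} {g τ : X → ℝ≥0∞}, γ.integral τ ≠ ⊤ →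
        (∀ γ' ∈ {γ : Curve X | ¬ UGOn w g γ}, γ'.integral τ = ⊤) →
        ∀ a b (ha : 0 ≤ a) (hab : a < b) (hb : b ≤ γ.len), UGOn w g (γ.sub a b ha hab hb) := by
      intro w g τ hτ hΓ a b ha hab hb
      by_contra hcon
      exact hτ (top_le_iff.1 ((hΓ _ hcon).symm.le.trans (γ.integral_sub_le τ ha hab hb)))
    obtain ⟨hur, huI⟩ := γ.real_of_forall_sub hne₂ (key hne₁ hρΓ)
    obtain ⟨hvr, hvI⟩ := γ.real_of_forall_sub hne₄ (key hne₃ hσΓ)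
    have hmem0 : (0 : ℝ) ∈ Icc 0 γ.len := ⟨le_rfl, γ.len_pos.le⟩
    have hmeml : γ.len ∈ Icc 0 γ.len := ⟨γ.len_pos.le, le_rfl⟩
    have hmain := ofReal_abs_max_sub_max_le_setLIntegral γ.len_pos.le
      (H := fun t ↦ G (γ.toFun t)) (γ.aemeasurable_comp hgu) hne₂ (γ.aemeasurable_comp hgv) hne₄
      huI hvI
      (fun t ht hlt ↦ h _ (by rw [← hur t ht, ← hvr t ht]; exact EReal.coe_lt_coe_iff.2 hlt))
      (fun t ht hle ↦ h' _ (by rw [← hur t ht, ← hvr t ht]; exact EReal.coe_le_coe_iff.2 hle))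
    rw [← ugDiff_coe, EReal.coe_strictMono.monotone.map_max,
      EReal.coe_strictMono.monotone.map_max, hur 0 hmem0, hvr 0 hmem0,
      hur _ hmeml, hvr _ hmeml] at hmain
    exact hmain

lemma IsWeakUpperGradient.min {p : ℝ} (hp : 1 ≤ p) {μ : Measure X} {u v : X → EReal}
    {gu gv G : X → ℝ≥0∞} (hu : IsWeakUpperGradient p μ u gu) (hv : IsWeakUpperGradient p μ v gv)
    (hufin : ∫⁻ x, gu x ^ p ∂μ < ⊤) (hvfin : ∫⁻ x, gv x ^ p ∂μ < ⊤) (hG : Measurable G)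
    (h : ∀ x, v x < u x → gv x ≤ G x) (h' : ∀ x, u x ≤ v x → gu x ≤ G x) :
    IsWeakUpperGradient p μ (fun x ↦ min (u x) (v x)) G := by
  have := (hv.neg.max hp hu.neg hvfin hufin hG (fun x hx ↦ h x (EReal.neg_lt_neg_iff.1 hx))
    (fun x hx ↦ h' x (EReal.neg_le_neg_iff.1 hx))).neg
  simpa only [EReal.max_neg_neg, neg_neg, min_comm] using this

/-- The energies of the maximum and the minimum of two functions add up to at most the sum of
the energies of the two functions. -/
lemma gradEnergy_max_add_gradEnergy_min_le {p : ℝ} (hp : 1 ≤ p) {μ : Measure X}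
    {u v : X → EReal} (hum : AEMeasurable u μ) (hvm : AEMeasurable v μ) :
    gradEnergy p μ (fun x ↦ max (u x) (v x)) + gradEnergy p μ (fun x ↦ min (u x) (v x)) ≤
      gradEnergy p μ u + gradEnergy p μ v := by
  classical
  refine ENNReal.le_iInf₂_add_iInf₂ fun gu hu gv hv ↦ ?_
  by_cases hufin : ∫⁻ x, gu x ^ p ∂μ = ⊤
  · simp [hufin]
  by_cases hvfin : ∫⁻ x, gv x ^ p ∂μ = ⊤
  · simp [hvfin]
  obtain ⟨B, hB, hBae⟩ := (nullMeasurableSet_lt hvm hum).exists_measurable_superset_ae_eq.imp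
    fun B hB ↦ hB.2
  set N : Set X := toMeasurable μ {x | ¬ (x ∈ B ↔ v x < u x)} with hN
  have hNm : MeasurableSet N := measurableSet_toMeasurable _ _
  have hN0 : ∀ᵐ x ∂μ, x ∉ N := by
    have : ∀ᵐ x ∂μ, (x ∈ B ↔ v x < u x) := hBae.mem_iff
    rw [← measure_eq_zero_iff_ae_notMem, hN, measure_toMeasurable]
    exact this
  have hsub : ∀ x, x ∉ N → (x ∈ B ↔ v x < u x) := by
    intro x hx
    by_contra hcon
    exact hx (subset_toMeasurable μ _ hcon)
  set G₁ : X → ℝ≥0∞ := N.piecewise (fun _ ↦ ⊤) (B.piecewise gu gv) with hG₁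
  set G₂ : X → ℝ≥0∞ := N.piecewise (fun _ ↦ ⊤) (B.piecewise gv gu) with hG₂
  have hG₁m : Measurable G₁ := measurable_const.piecewise hNm (hu.1.piecewise hB hv.1)
  have hG₂m : Measurable G₂ := measurable_const.piecewise hNm (hv.1.piecewise hB hu.1)
  have hmax : IsWeakUpperGradient p μ (fun x ↦ max (u x) (v x)) G₁ := by
    refine hu.max hp hv (Ne.lt_top hufin) (Ne.lt_top hvfin) hG₁m ?_ ?_ <;>
    · intro x hx
      by_cases hxN : x ∈ N
      · simp [hG₁, hxN]
      · simp [hG₁, hxN, hsub x hxN, hx, hx.not_gt]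
  have hmin : IsWeakUpperGradient p μ (fun x ↦ min (u x) (v x)) G₂ := by
    refine hu.min hp hv (Ne.lt_top hufin) (Ne.lt_top hvfin) hG₂m ?_ ?_ <;>
    · intro x hx
      by_cases hxN : x ∈ N
      · simp [hG₂, hxN]
      · simp [hG₂, hxN, hsub x hxN, hx, hx.not_gt]
  calc _ ≤ (∫⁻ x, G₁ x ^ p ∂μ) + ∫⁻ x, G₂ x ^ p ∂μ :=
        add_le_add (iInf₂_le _ hmax) (iInf₂_le _ hmin)
    _ = ∫⁻ x, G₁ x ^ p + G₂ x ^ p ∂μ := (lintegral_add_left (hG₁m.pow_const p) _).symm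
    _ = ∫⁻ x, gu x ^ p + gv x ^ p ∂μ := by
        refine lintegral_congr_ae ?_
        filter_upwards [hN0] with x hxN
        by_cases hxB : x ∈ B
        · simp [hG₁, hG₂, hxN, hxB]
        · simp [hG₁, hG₂, hxN, hxB, add_comm]
    _ = (∫⁻ x, gu x ^ p ∂μ) + ∫⁻ x, gv x ^ p ∂μ := lintegral_add_left (hu.1.pow_const p) _

lemma lintegral_abs_rpow_lt_top_of_or {p : ℝ} {μ : Measure X} {u v w : X → EReal}
    (hum : AEMeasurable u μ) (hu : ∫⁻ x, (u x).abs ^ p ∂μ < ⊤)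
    (hv : ∫⁻ x, (v x).abs ^ p ∂μ < ⊤) (hw : ∀ x, w x = u x ∨ w x = v x) :
    ∫⁻ x, (w x).abs ^ p ∂μ < ⊤ := by
  have habs : Measurable EReal.abs :=
    EReal.measurable_of_measurable_real measurable_norm.ennreal_ofReal
  calc ∫⁻ x, (w x).abs ^ p ∂μ ≤ ∫⁻ x, (u x).abs ^ p + (v x).abs ^ p ∂μ := by
        refine lintegral_mono fun x ↦ ?_
        rcases hw x with h | h <;> simp [h]
    _ = (∫⁻ x, (u x).abs ^ p ∂μ) + ∫⁻ x, (v x).abs ^ p ∂μ :=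
        lintegral_add_left' ((habs.comp_aemeasurable hum).pow_const p) _
    _ < ⊤ := ENNReal.add_lt_top.2 ⟨hu, hv⟩

/-- The variational capacity is strongly subadditive. -/
lemma varCapacity_union_add_varCapacity_inter_le {p : ℝ} (hp : 1 ≤ p) (μ : Measure X)
    (A B E : Set X) :
    varCapacity p μ (A ∪ B) E + varCapacity p μ (A ∩ B) E ≤
      varCapacity p μ A E + varCapacity p μ B E := by
  refine ENNReal.le_iInf₂_add_iInf₂ ?_
  rintro u ⟨⟨⟨hum, hufin⟩, hu0⟩, hu1⟩ v ⟨⟨⟨hvm, hvfin⟩, hv0⟩, hv1⟩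
  obtain ⟨hup, hug⟩ := ENNReal.add_lt_top.1 hufin
  obtain ⟨hvp, hvg⟩ := ENNReal.add_lt_top.1 hvfin
  have henergy := gradEnergy_max_add_gradEnergy_min_le hp hum hvm
  obtain ⟨hmaxg, hming⟩ :=
    ENNReal.add_lt_top.1 (henergy.trans_lt (ENNReal.add_lt_top.2 ⟨hug, hvg⟩))
  refine le_trans (add_le_add (iInf₂_le (fun x ↦ max (u x) (v x)) ⟨⟨⟨hum.max hvm, ?_⟩, ?_⟩, ?_⟩)
    (iInf₂_le (fun x ↦ min (u x) (v x)) ⟨⟨⟨hum.min hvm, ?_⟩, ?_⟩, ?_⟩)) henergy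
  · exact ENNReal.add_lt_top.2
      ⟨lintegral_abs_rpow_lt_top_of_or hum hup hvp fun x ↦ max_choice _ _, hmaxg⟩
  · intro x hx
    simp [hu0 x hx, hv0 x hx]
  · rintro x (hx | hx)
    · exact le_max_of_le_left (hu1 x hx)
    · exact le_max_of_le_right (hv1 x hx)
  · exact ENNReal.add_lt_top.2
      ⟨lintegral_abs_rpow_lt_top_of_or hum hup hvp fun x ↦ min_choice _ _, hming⟩
  · intro x hx
    simp [hu0 x hx, hv0 x hx]
  · exact fun x hx ↦ le_min (hu1 x hx.1) (hv1 x hx.2)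

lemma varCapacity_mono {p : ℝ} {μ : Measure X} {A B E : Set X} (h : A ⊆ B) :
    varCapacity p μ A E ≤ varCapacity p μ B E :=
  le_iInf₂ fun u hu ↦ iInf₂_le u ⟨hu.1, fun x hx ↦ hu.2 x (h hx)⟩

/-- Lemma on increasing sets `Aⱼ` and almost-optimal supersets `Gⱼ`. -/
theorem stmt_10 (p : ℝ) (hp : 1 ≤ p) (μ : Measure X)
    (hball : ∀ (x : X) (r : ℝ), 0 < r → 0 < μ (Metric.ball x r) ∧ μ (Metric.ball x r) < ⊤)
    (E : Set X) (hE : Bornology.IsBounded E)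
    (A G : ℕ → Set X) (ε : ℕ → ℝ≥0∞)
    (hmono : ∀ j, A j ⊆ A (j + 1)) (hAE : ∀ j, A j ⊆ E)
    (hfin : ∀ j, varCapacity p μ (A j) E < ⊤)
    (hGE : ∀ j, G j ⊆ E) (hAG : ∀ j, A j ⊆ G j)
    (hε : ∀ j, 0 < ε j)
    (hG : ∀ j, varCapacity p μ (G j) E ≤ varCapacity p μ (A j) E + ε j) :
    ∀ k : ℕ, varCapacity p μ (⋃ j ∈ Finset.range (k + 1), G j) E ≤
      varCapacity p μ (A k) E + ∑ j ∈ Finset.range (k + 1), ε j := by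
  intro k
  induction k with
  | zero => simpa using hG 0
  | succ k ih =>
    have hunion : ⋃ j ∈ Finset.range (k + 1 + 1), G j =
        (⋃ j ∈ Finset.range (k + 1), G j) ∪ G (k + 1) := by
      rw [Finset.range_add_one, Finset.set_biUnion_insert, union_comm]
    have hinter : A k ⊆ (⋃ j ∈ Finset.range (k + 1), G j) ∩ G (k + 1) :=
      fun x hx ↦ ⟨mem_biUnion (Finset.self_mem_range_succ k) (hAG k hx),
        hAG (k + 1) (hmono k hx)⟩
    rw [hunion, Finset.sum_range_succ]
    refine (ENNReal.add_le_add_iff_right (hfin k).ne).1 ?_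
    calc _ ≤ _ := add_le_add le_rfl (varCapacity_mono hinter)
      _ ≤ _ := varCapacity_union_add_varCapacity_inter_le hp μ _ _ E
      _ ≤ _ := add_le_add ih (hG (k + 1))
      _ = _ := by ring

end
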